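/- Let n, m ∈ ℕ and let F : P_{n,m} → ℝ be a polarized function on the prism grid P_{n,m}. If the restriction of F to the ground (face z = 0) and the restriction of F to the front wall (face y = 0) are discrete concave, then F is polarized discrete concave on P_{n,m}, i.e. all rhombus inequalities whose four points lie in P_{n,m} hold; in particular, the restrictions of F to the shadow wall (face x = 0) and to the ceiling (face z = m) are discrete concave. -/

import Mathlib

/-- Points of the three-dimensional lattice. -/
abbrev V3 : Type := ℤ × ℤ × ℤ

def e1 : V3 := (1, 0, 0)
def e2 : V3 := (0, 1, 0)
def e3 : V3 := (0, 0, 1)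

/-- The unimodular set `D = {e₁, e₂, e₃, e₁−e₂, e₁−e₃, e₂−e₃}`. -/
def Dset : Set V3 := {e1, e2, e3, e1 - e2, e1 - e3, e2 - e3}

/-- The set `±D = D ∪ (−D)`. -/
def pmD : Set V3 := {v | v ∈ Dset ∨ -v ∈ Dset}

/-- `F` is polarized on `S`: for every primitive octahedron contained in `S`, the sum of the
values at the ends of the main diagonal (direction `(−1,1,1)`) equals the maximum of the sums
at the ends of the two other diagonals. -/
def IsPolarizedOn (S : Set V3) (F : V3 → ℝ) : Prop :=
  ∀ p : V3, p ∈ S → p + (-1, 1, 1) ∈ S → p + (0, 0, 1) ∈ S → p + (-1, 1, 0) ∈ S →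
    p + (0, 1, 0) ∈ S → p + (-1, 0, 1) ∈ S →
    F p + F (p + (-1, 1, 1)) =
      max (F (p + (0, 0, 1)) + F (p + (-1, 1, 0))) (F (p + (0, 1, 0)) + F (p + (-1, 0, 1)))

/-- `(q, q+a, q+b, q+a+b)` is a primitive rhombus: `a, b ∈ ±D`, `a ≠ ±b`, and one of the
diagonal directions `a+b`, `a−b` lies in `±D` (that diagonal is the short one). -/
def IsPrimRhombus (a b : V3) : Prop :=
  a ∈ pmD ∧ b ∈ pmD ∧ a ≠ b ∧ a ≠ -b ∧ (a + b ∈ pmD ∨ a - b ∈ pmD)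

/-- The rhombus inequalities associated to the primitive rhombus `(q, q+a, q+b, q+a+b)`:
the sum at the short diagonal is at least the sum at the long diagonal. -/
def RhombusIneq (F : V3 → ℝ) (q a b : V3) : Prop :=
  (a + b ∈ pmD → F q + F (q + a + b) ≥ F (q + a) + F (q + b)) ∧
  (a - b ∈ pmD → F (q + a) + F (q + b) ≥ F q + F (q + a + b))

/-- All rhombus inequalities for primitive rhombi whose four points lie in `S` hold. -/
def DiscreteConcaveOn (S : Set V3) (F : V3 → ℝ) : Prop :=
  ∀ q a b : V3, IsPrimRhombus a b → q ∈ S → q + a ∈ S → q + b ∈ S → q + a + b ∈ S →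
    RhombusIneq F q a b

/-- `F` is polarized discrete concave on `S`. -/
def PDCOn (S : Set V3) (F : V3 → ℝ) : Prop :=
  IsPolarizedOn S F ∧ DiscreteConcaveOn S F

/-- The tetrahedral grid `Δ_n(OXYZ)`. -/
def Tet (n : ℕ) : Set V3 :=
  {v | 0 ≤ v.1 ∧ 0 ≤ v.2.1 ∧ 0 ≤ v.2.2 ∧ v.1 + v.2.1 + v.2.2 ≤ (n : ℤ)}

/-- The ground face `z = 0` of `Δ_n(OXYZ)`. -/
def ground (n : ℕ) : Set V3 := {v | v ∈ Tet n ∧ v.2.2 = 0}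

/-- The front wall `y = 0` of `Δ_n(OXYZ)`. -/
def frontWall (n : ℕ) : Set V3 := {v | v ∈ Tet n ∧ v.2.1 = 0}

/-- The shadow wall `x = 0` of `Δ_n(OXYZ)`. -/
def shadowWall (n : ℕ) : Set V3 := {v | v ∈ Tet n ∧ v.1 = 0}

/-- The slope wall `x + y + z = n` of `Δ_n(OXYZ)`. -/
def slopeWall (n : ℕ) : Set V3 := {v | v ∈ Tet n ∧ v.1 + v.2.1 + v.2.2 = (n : ℤ)}

/-- The family `R(d)` of rhombus inequalities on `S` for rhombi whose short diagonal has
direction `±d`. -/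
def FaceR (S : Set V3) (F : V3 → ℝ) (d : V3) : Prop :=
  ∀ q a b : V3, IsPrimRhombus a b → q ∈ S → q + a ∈ S → q + b ∈ S → q + a + b ∈ S →
    ((a + b = d ∨ a + b = -d) → F q + F (q + a + b) ≥ F (q + a) + F (q + b)) ∧
    ((a - b = d ∨ a - b = -d) → F (q + a) + F (q + b) ≥ F q + F (q + a + b))

/-- The prism grid `P_{n,m} = Δ_n(OXY) × {0,…,m}`. -/
def Prism (n m : ℕ) : Set V3 :=
  {v | 0 ≤ v.1 ∧ 0 ≤ v.2.1 ∧ v.1 + v.2.1 ≤ (n : ℤ) ∧ 0 ≤ v.2.2 ∧ v.2.2 ≤ (m : ℤ)}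

/-- The ground `z = 0` of the prism. -/
def prismGround (n m : ℕ) : Set V3 := {v | v ∈ Prism n m ∧ v.2.2 = 0}

/-- The ceiling `z = m` of the prism. -/
def prismCeiling (n m : ℕ) : Set V3 := {v | v ∈ Prism n m ∧ v.2.2 = (m : ℤ)}

/-- The front wall `y = 0` of the prism. -/
def prismFront (n m : ℕ) : Set V3 := {v | v ∈ Prism n m ∧ v.2.1 = 0}

/-- The shadow wall `x = 0` of the prism. -/
def prismShadow (n m : ℕ) : Set V3 := {v | v ∈ Prism n m ∧ v.1 = 0}

/-- The slope face `x + y = n` of the prism. -/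
def prismSlope (n m : ℕ) : Set V3 := {v | v ∈ Prism n m ∧ v.1 + v.2.1 = (n : ℤ)}

/-- `F` is polarized on the prism: the octahedron recurrence holds for primitive octahedra in
the prism, and on the non-modular slope face the recurrence degenerates to separability. -/
def IsPolarizedPrism (n m : ℕ) (F : V3 → ℝ) : Prop :=
  IsPolarizedOn (Prism n m) F ∧
  ∀ q : V3, q ∈ prismSlope n m → q + (-1, 1, 0) ∈ prismSlope n m →
    q + (0, 0, 1) ∈ prismSlope n m → q + (-1, 1, 1) ∈ prismSlope n m →
    F q + F (q + (-1, 1, 1)) = F (q + (-1, 1, 0)) + F (q + (0, 0, 1))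

/-- The octahedron recurrence on the prism `x, y ≥ 0`, `x + y ≤ N`, `0 ≤ z ≤ M`, in coordinates,
degenerating on the face `x + y = N`: the main diagonal dominates both other diagonals (where they
lie in the prism) and equals one of them. -/
structure PrismRecurrence (N M : ℤ) (f : ℤ → ℤ → ℤ → ℝ) : Prop where
  le_left : ∀ x y z, 1 ≤ x → 0 ≤ y → x + y ≤ N → 0 ≤ z → z + 1 ≤ M →
    f x y (z + 1) + f (x - 1) (y + 1) z ≤ f x y z + f (x - 1) (y + 1) (z + 1)
  le_right : ∀ x y z, 1 ≤ x → 0 ≤ y → x + y + 1 ≤ N → 0 ≤ z → z + 1 ≤ M →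
    f x (y + 1) z + f (x - 1) y (z + 1) ≤ f x y z + f (x - 1) (y + 1) (z + 1)
  eq_or : ∀ x y z, 1 ≤ x → 0 ≤ y → x + y ≤ N → 0 ≤ z → z + 1 ≤ M →
    f x y z + f (x - 1) (y + 1) (z + 1) = f x y (z + 1) + f (x - 1) (y + 1) z ∨
    x + y + 1 ≤ N ∧
      f x y z + f (x - 1) (y + 1) (z + 1) = f x (y + 1) z + f (x - 1) y (z + 1)

/-- The inequalities for rhombi in a plane `z = const`, by direction of the short diagonal. -/
structure HorizontalIneqs (N z : ℤ) (f : ℤ → ℤ → ℤ → ℝ) : Prop where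
  short_e1 : ∀ x y, 1 ≤ x → 0 ≤ y → x + y + 1 ≤ N →
    f x y z + f (x - 1) (y + 2) z ≤ f (x - 1) (y + 1) z + f x (y + 1) z
  short_e1_sub_e2 : ∀ x y, 0 ≤ x → 0 ≤ y → x + y + 2 ≤ N →
    f (x + 1) (y + 1) z + f x y z ≤ f (x + 1) y z + f x (y + 1) z
  short_e2 : ∀ x y, 2 ≤ x → 0 ≤ y → x + y ≤ N →
    f (x - 2) (y + 1) z + f x y z ≤ f (x - 1) y z + f (x - 1) (y + 1) z

/-- The inequalities for rhombi in a plane `y = const`, by direction of the short diagonal. -/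
structure FrontalIneqs (N M y : ℤ) (f : ℤ → ℤ → ℤ → ℝ) : Prop where
  short_e1 : ∀ x z, 1 ≤ x → x + y ≤ N → 0 ≤ z → z + 2 ≤ M →
    f x y z + f (x - 1) y (z + 2) ≤ f (x - 1) y (z + 1) + f x y (z + 1)
  short_e1_sub_e3 : ∀ x z, 0 ≤ x → x + y + 1 ≤ N → 0 ≤ z → z + 1 ≤ M →
    f (x + 1) y (z + 1) + f x y z ≤ f (x + 1) y z + f x y (z + 1)
  short_e3 : ∀ x z, 2 ≤ x → x + y ≤ N → 0 ≤ z → z + 1 ≤ M →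
    f (x - 2) y (z + 1) + f x y z ≤ f (x - 1) y z + f (x - 1) y (z + 1)

namespace PrismRecurrence

variable {N M : ℤ} {f : ℤ → ℤ → ℤ → ℝ}

/-- Rhombi in a plane `x = const` with short diagonal `e₃`, from the horizontal plane below. -/
theorem sagittal_short_e3 (R : PrismRecurrence N M f) {x y z : ℤ}
    (H : f (x + 1) (y - 1) z + f x (y + 1) z ≤ f x y z + f (x + 1) y z)
    (hx : 0 ≤ x) (hy : 1 ≤ y) (hxy : x + y + 1 ≤ N) (hz : 0 ≤ z) (hzM : z + 1 ≤ M) :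
    f x (y - 1) (z + 1) + f x (y + 1) z ≤ f x y (z + 1) + f x y z := by
  have h := R.le_right (x + 1) (y - 1) z (by omega) (by omega) (by omega) hz hzM
  simp only [add_sub_cancel_right, sub_add_cancel] at h
  linarith

/-- Rhombi in a plane `x + y + z = const` with short diagonal `e₁ - e₃`, from the horizontal plane
below. -/
theorem slanted_short_e1_sub_e3 (R : PrismRecurrence N M f) {x y z : ℤ}
    (H : f x (y - 1) z + f (x - 1) (y + 1) z ≤ f (x - 1) y z + f x y z)
    (hx : 1 ≤ x) (hy : 1 ≤ y) (hxy : x + y ≤ N) (hz : 0 ≤ z) (hzM : z + 1 ≤ M) :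
    f x (y - 1) (z + 1) + f (x - 1) (y + 1) z ≤ f (x - 1) y (z + 1) + f x y z := by
  have h := R.le_left x (y - 1) z (by omega) (by omega) (by omega) hz hzM
  simp only [sub_add_cancel] at h
  linarith

/-- Rhombi in a plane `x = const` with short diagonal `e₂`, from the frontal plane in front. -/
theorem sagittal_short_e2 (R : PrismRecurrence N M f) {x y z : ℤ}
    (H : f (x + 1) y (z - 1) + f x y (z + 1) ≤ f x y z + f (x + 1) y z)
    (hx : 0 ≤ x) (hy : 0 ≤ y) (hxy : x + y + 1 ≤ N) (hz : 1 ≤ z) (hzM : z + 1 ≤ M) :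
    f x (y + 1) (z - 1) + f x y (z + 1) ≤ f x (y + 1) z + f x y z := by
  have h := R.le_left (x + 1) y (z - 1) (by omega) (by omega) (by omega) (by omega) (by omega)
  simp only [add_sub_cancel_right, sub_add_cancel] at h
  linarith

/-- Rhombi in a plane `x + y + z = const` with short diagonal `e₁ - e₂`, from the frontal plane in
front. -/
theorem slanted_short_e1_sub_e2 (R : PrismRecurrence N M f) {x y z : ℤ}
    (H : f x y (z - 1) + f (x - 1) y (z + 1) ≤ f (x - 1) y z + f x y z)
    (hx : 1 ≤ x) (hy : 0 ≤ y) (hxy : x + y + 1 ≤ N) (hz : 1 ≤ z) (hzM : z + 1 ≤ M) :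
    f x (y + 1) (z - 1) + f (x - 1) y (z + 1) ≤ f (x - 1) (y + 1) z + f x y z := by
  have h := R.le_right x y (z - 1) (by omega) (by omega) (by omega) (by omega) (by omega)
  simp only [sub_add_cancel] at h
  linarith

theorem horizontal_short_e1 (R : PrismRecurrence N M f) (H : HorizontalIneqs N 0 f) {z : ℤ}
    (hz : 0 ≤ z) : z ≤ M → ∀ x y, 1 ≤ x → 0 ≤ y → x + y + 1 ≤ N →
    f x y z + f (x - 1) (y + 2) z ≤ f (x - 1) (y + 1) z + f x (y + 1) z := by
  induction z, hz using Int.leInduction with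
  | base => exact fun _ => H.short_e1
  | succ z hz ih =>
    intro hzM x y hx hy hxy
    have h := ih (by omega) x y hx hy hxy
    ring_nf
    rcases R.eq_or x (y + 1) z hx (by omega) (by omega) hz hzM with h₃ | ⟨hxy', h₃⟩
    · have h₁ := R.slanted_short_e1_sub_e3 (x := x) (y := y + 1) (z := z)
        (by ring_nf at h ⊢; linarith) hx (by omega) (by omega) hz hzM
      ring_nf at h₁ h₃
      linarith
    · have h' := ih (by omega) (x + 1) y (by omega) hy (by omega)
      have h₂ := R.sagittal_short_e3 (x := x) (y := y + 1) (z := z)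
        (by ring_nf at h' ⊢; linarith) (by omega) (by omega) (by omega) hz hzM
      ring_nf at h₂ h₃
      linarith

theorem frontal_short_e1 (R : PrismRecurrence N M f) (H : FrontalIneqs N M 0 f) {y : ℤ}
    (hy : 0 ≤ y) : ∀ x z, 1 ≤ x → x + y ≤ N → 0 ≤ z → z + 2 ≤ M →
    f x y z + f (x - 1) y (z + 2) ≤ f (x - 1) y (z + 1) + f x y (z + 1) := by
  induction y, hy using Int.leInduction with
  | base => exact H.short_e1
  | succ y hy ih =>
    intro x z hx hxy hz hzM
    have h := ih x z hx (by omega) hz hzM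
    have h' := ih (x + 1) z (by omega) (by omega) hz hzM
    have h₁ := R.slanted_short_e1_sub_e2 (x := x) (y := y) (z := z + 1) (by ring_nf at h ⊢; linarith)
      hx hy (by omega) (by omega) (by omega)
    have h₂ := R.sagittal_short_e2 (x := x) (y := y) (z := z + 1) (by ring_nf at h' ⊢; linarith)
      (by omega) hy (by omega) (by omega) (by omega)
    ring_nf at h₁ h₂ ⊢
    rcases R.eq_or x y (z + 1) hx (by omega) (by omega) (by omega) (by omega) with h₃ | ⟨-, h₃⟩ <;>
    · ring_nf at h₃
      linarith

/-- The inequalities with short diagonals `e₁ - e₂` (horizontal) and `e₁ - e₃` (frontal) propagate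
together, by induction on `y + z`. -/
theorem short_e1_sub (R : PrismRecurrence N M f) (H : HorizontalIneqs N 0 f)
    (H' : FrontalIneqs N M 0 f) (k : ℕ) : ∀ x y z : ℤ, 0 ≤ x → 0 ≤ y → 0 ≤ z → y + z ≤ k →
    (x + y + 2 ≤ N → z ≤ M →
      f (x + 1) (y + 1) z + f x y z ≤ f (x + 1) y z + f x (y + 1) z) ∧
    (x + y + 1 ≤ N → z + 1 ≤ M →
      f (x + 1) y (z + 1) + f x y z ≤ f (x + 1) y z + f x y (z + 1)) := by
  induction k with
  | zero =>
    intro x y z hx hy hz hk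
    obtain rfl : y = 0 := by omega
    obtain rfl : z = 0 := by omega
    exact ⟨fun h _ => H.short_e1_sub_e2 x 0 hx le_rfl h,
      fun h h' => H'.short_e1_sub_e3 x 0 hx h le_rfl h'⟩
  | succ k ih =>
    intro x y z hx hy hz hk
    push_cast at hk
    refine ⟨fun hxy hzM => ?_, fun hxy hzM => ?_⟩
    · rcases hz.eq_or_lt with rfl | hz
      · exact H.short_e1_sub_e2 x y hx hy hxy
      · have h₁ := R.le_right (x + 1) y (z - 1) (by omega) hy (by omega) (by omega) (by omega)
        have h₂ := (ih x y (z - 1) hx hy (by omega) (by omega)).2 (by omega) (by omega)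
        have h₂' := (ih (x + 1) y (z - 1) (by omega) hy (by omega) (by omega)).2
          (by omega) (by omega)
        ring_nf at h₁ h₂ h₂' ⊢
        rcases R.eq_or (x + 2) y (z - 1) (by omega) hy (by omega) (by omega) (by omega) with
          h₃ | ⟨h, h₃⟩
        · ring_nf at h₃
          linarith
        · have h₄ := (ih (x + 1) y (z - 1) (by omega) hy (by omega) (by omega)).1
            (by omega) (by omega)
          ring_nf at h₃ h₄
          linarith
    · rcases hy.eq_or_lt with rfl | hy
      · exact H'.short_e1_sub_e3 x z hx hxy hz hzM
      · have h₁ := R.le_left (x + 1) (y - 1) z (by omega) (by omega) (by omega) hz hzM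
        have h₂ := (ih (x + 1) (y - 1) z (by omega) (by omega) hz (by omega)).2
          (by omega) hzM
        ring_nf at h₁ h₂ ⊢
        rcases R.eq_or (x + 2) (y - 1) z (by omega) (by omega) (by omega) hz hzM with
          h₃ | ⟨h, h₃⟩
        · ring_nf at h₃
          linarith
        · have h₄ := (ih (x + 1) (y - 1) z (by omega) (by omega) hz (by omega)).1
            (by omega) (by omega)
          ring_nf at h₃ h₄
          linarith

/-- The inequalities with short diagonals `e₂` (horizontal) and `e₃` (frontal) propagate together,
by induction on `y + z`. -/
theorem short_e2_e3 (R : PrismRecurrence N M f) (H : HorizontalIneqs N 0 f)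
    (H' : FrontalIneqs N M 0 f) (k : ℕ) : ∀ x y z : ℤ, 2 ≤ x → 0 ≤ y → 0 ≤ z → y + z ≤ k →
    x + y ≤ N →
    (z ≤ M → f (x - 2) (y + 1) z + f x y z ≤ f (x - 1) y z + f (x - 1) (y + 1) z) ∧
    (z + 1 ≤ M → f (x - 2) y (z + 1) + f x y z ≤ f (x - 1) y z + f (x - 1) y (z + 1)) := by
  induction k with
  | zero =>
    intro x y z hx hy hz hk hxy
    obtain rfl : y = 0 := by omega
    obtain rfl : z = 0 := by omega
    exact ⟨fun _ => H.short_e2 x 0 hx le_rfl hxy, fun h => H'.short_e3 x 0 hx hxy le_rfl h⟩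
  | succ k ih =>
    intro x y z hx hy hz hk hxy
    push_cast at hk
    refine ⟨fun hzM => ?_, fun hzM => ?_⟩
    · rcases hz.eq_or_lt with rfl | hz
      · exact H.short_e2 x y hx hy hxy
      · have h₁ := R.le_left x y (z - 1) (by omega) hy hxy (by omega) (by omega)
        have h₂ := ih x y (z - 1) hx hy (by omega) (by omega) hxy
        have h₄ := h₂.1 (by omega)
        have h₅ := h₂.2 (by omega)
        ring_nf at h₁ h₄ h₅ ⊢
        rcases R.eq_or (x - 1) y (z - 1) (by omega) hy (by omega) (by omega) (by omega) with
          h₃ | ⟨-, h₃⟩ <;>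
        · ring_nf at h₃
          linarith
    · rcases hy.eq_or_lt with rfl | hy
      · exact H'.short_e3 x z hx hxy hz hzM
      · have h₁ := R.le_right x (y - 1) z (by omega) (by omega) (by omega) hz hzM
        have h₂ := ih x (y - 1) z hx (by omega) hz (by omega) (by omega)
        have h₄ := h₂.1 (by omega)
        have h₅ := h₂.2 (by omega)
        ring_nf at h₁ h₄ h₅ ⊢
        rcases R.eq_or (x - 1) (y - 1) z (by omega) (by omega) (by omega) hz hzM with
          h₃ | ⟨-, h₃⟩ <;>
        · ring_nf at h₃
          linarith

theorem horizontalIneqs (R : PrismRecurrence N M f) (H : HorizontalIneqs N 0 f)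
    (H' : FrontalIneqs N M 0 f) {z : ℤ} (hz : 0 ≤ z) (hzM : z ≤ M) : HorizontalIneqs N z f where
  short_e1 := R.horizontal_short_e1 H hz hzM
  short_e1_sub_e2 x y hx hy hxy :=
    (R.short_e1_sub H H' (y + z).toNat x y z hx hy hz (by omega)).1 hxy hzM
  short_e2 x y hx hy hxy :=
    (R.short_e2_e3 H H' (y + z).toNat x y z hx hy hz (by omega) hxy).1 hzM

theorem frontalIneqs (R : PrismRecurrence N M f) (H : HorizontalIneqs N 0 f)
    (H' : FrontalIneqs N M 0 f) {y : ℤ} (hy : 0 ≤ y) : FrontalIneqs N M y f where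
  short_e1 := R.frontal_short_e1 H' hy
  short_e1_sub_e3 x z hx hxy hz hzM :=
    (R.short_e1_sub H H' (y + z).toNat x y z hx hy hz (by omega)).2 hxy hzM
  short_e3 x z hx hxy hz hzM :=
    (R.short_e2_e3 H H' (y + z).toNat x y z hx hy hz (by omega) hxy).2 hzM

/-- Rhombi in a plane `x = const` with short diagonal `e₂ - e₃`. -/
theorem sagittal_short_e2_sub_e3 (R : PrismRecurrence N M f) {x y z : ℤ}
    (H : HorizontalIneqs N z f) (H' : FrontalIneqs N M y f)
    (hx : 0 ≤ x) (hy : 0 ≤ y) (hxy : x + y + 1 ≤ N) (hz : 0 ≤ z) (hzM : z + 1 ≤ M) :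
    f x (y + 1) (z + 1) + f x y z ≤ f x (y + 1) z + f x y (z + 1) := by
  have h₁ := H'.short_e1_sub_e3 x z hx hxy hz hzM
  rcases R.eq_or (x + 1) y z (by omega) hy (by omega) hz hzM with h₃ | ⟨h, h₃⟩
  · simp only [add_sub_cancel_right] at h₃
    linarith
  · have h₂ := H.short_e1_sub_e2 x y hx hy (by omega)
    simp only [add_sub_cancel_right] at h₃
    linarith

/-- Rhombi in a plane `x + y + z = const` with short diagonal `e₂ - e₃`. -/
theorem slanted_short_e2_sub_e3 (R : PrismRecurrence N M f) {x y z : ℤ}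
    (H : HorizontalIneqs N z f) (H' : FrontalIneqs N M y f)
    (hx : 2 ≤ x) (hy : 0 ≤ y) (hxy : x + y ≤ N) (hz : 0 ≤ z) (hzM : z + 1 ≤ M) :
    f (x - 2) (y + 1) (z + 1) + f x y z ≤ f (x - 1) (y + 1) z + f (x - 1) y (z + 1) := by
  have h₁ := H'.short_e3 x z hx hxy hz hzM
  have h₂ := H.short_e2 x y hx hy hxy
  rcases R.eq_or (x - 1) y z (by omega) hy (by omega) hz hzM with h₃ | ⟨-, h₃⟩ <;>
  · simp only [sub_sub, Int.reduceAdd] at h₃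
    linarith

end PrismRecurrence

theorem IsPolarizedPrism.prismRecurrence {n m : ℕ} {F : V3 → ℝ} (h : IsPolarizedPrism n m F) :
    PrismRecurrence n m fun x y z => F (x, y, z) := by
  have slope : ∀ x y z : ℤ, 1 ≤ x → 0 ≤ y → x + y = n → 0 ≤ z → z + 1 ≤ m →
      F (x, y, z) + F (x - 1, y + 1, z + 1) = F (x, y, z + 1) + F (x - 1, y + 1, z) := by
    intro x y z hx hy hxy hz hzm
    have := h.2 (x, y, z)
    simp only [prismSlope, Prism, Set.mem_ofPred_eq, Prod.mk_add_mk, add_zero,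
      ← sub_eq_add_neg] at this
    rw [add_comm (F (x, y, z + 1))]
    apply this <;> omega
  have octa : ∀ x y z : ℤ, 1 ≤ x → 0 ≤ y → x + y + 1 ≤ n → 0 ≤ z → z + 1 ≤ m →
      F (x, y, z) + F (x - 1, y + 1, z + 1) =
        max (F (x, y, z + 1) + F (x - 1, y + 1, z)) (F (x, y + 1, z) + F (x - 1, y, z + 1)) := by
    intro x y z hx hy hxy hz hzm
    have := h.1 (x, y, z)
    simp only [Prism, Set.mem_ofPred_eq, Prod.mk_add_mk, add_zero, ← sub_eq_add_neg] at this
    apply this <;> omega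
  refine ⟨fun x y z hx hy hxy hz hzm => ?_, fun x y z hx hy hxy hz hzm => ?_,
    fun x y z hx hy hxy hz hzm => ?_⟩
  · rcases hxy.eq_or_lt with hxy | hxy
    · exact (slope x y z hx hy hxy hz hzm).ge
    · exact (octa x y z hx hy hxy hz hzm).symm ▸ le_max_left _ _
  · exact (octa x y z hx hy hxy hz hzm).symm ▸ le_max_right _ _
  · rcases hxy.eq_or_lt with hxy | hxy
    · exact .inl (slope x y z hx hy hxy hz hzm)
    · rw [octa x y z hx hy hxy hz hzm]
      exact (max_choice _ _).imp_right fun h => ⟨hxy, h⟩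

theorem mem_pmD {x y z : ℤ} : ((x, y, z) : V3) ∈ pmD ↔
    x = 1 ∧ y = 0 ∧ z = 0 ∨ x = 0 ∧ y = 1 ∧ z = 0 ∨ x = 0 ∧ y = 0 ∧ z = 1 ∨
    x = 1 ∧ y = -1 ∧ z = 0 ∨ x = 1 ∧ y = 0 ∧ z = -1 ∨ x = 0 ∧ y = 1 ∧ z = -1 ∨
    x = -1 ∧ y = 0 ∧ z = 0 ∨ x = 0 ∧ y = -1 ∧ z = 0 ∨ x = 0 ∧ y = 0 ∧ z = -1 ∨
    x = -1 ∧ y = 1 ∧ z = 0 ∨ x = -1 ∧ y = 0 ∧ z = 1 ∨ x = 0 ∧ y = -1 ∧ z = 1 := by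
  simp only [pmD, Dset, e1, e2, e3, Set.mem_ofPred_eq, Set.mem_insert_iff, Set.mem_singleton_iff,
    Prod.mk_sub_mk, Prod.neg_mk, Prod.mk.injEq, neg_eq_iff_eq_neg, or_assoc, sub_zero, sub_self,
    zero_sub, neg_zero, neg_neg]

theorem neg_mem_pmD {v : V3} : -v ∈ pmD ↔ v ∈ pmD := by
  simp only [pmD, Set.mem_ofPred_eq, neg_neg, or_comm]

/-- A single rhombus inequality, written at the ends of the sides of the rhombus. -/
theorem DiscreteConcaveOn.le {S : Set V3} {F : V3 → ℝ} (h : DiscreteConcaveOn S F)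
    (x y z a b c a' b' c' : ℤ) (hq : (x, y, z) ∈ S) (ha : (x + a, y + b, z + c) ∈ S)
    (hb : (x + a', y + b', z + c') ∈ S) (hab : (x + a + a', y + b + b', z + c + c') ∈ S)
    (hda : ((a, b, c) : V3) ∈ pmD) (hdb : ((a', b', c') : V3) ∈ pmD)
    (hd : ((a - a', b - b', c - c') : V3) ∈ pmD) :
    F (x, y, z) + F (x + a + a', y + b + b', z + c + c') ≤
      F (x + a, y + b, z + c) + F (x + a', y + b', z + c') := by
  refine (h (x, y, z) (a, b, c) (a', b', c') ⟨hda, hdb, ?_, ?_, .inr hd⟩ hq ha hb hab).2 hd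
  · rintro ⟨⟩
    simp [mem_pmD] at hd
  · intro h
    simp only [Prod.neg_mk, Prod.mk.injEq] at h
    rw [mem_pmD] at hd
    omega

/-- It suffices to check the rhombi `q, q + b, q + b + d, q + b + b + d` with short diagonal
`d ∈ D`, and for these only one of the two orientations of the long diagonal `b + b + d`. -/
theorem DiscreteConcaveOn.of_le {S : Set V3} {F : V3 → ℝ}
    (h : ∀ q d b : V3, d ∈ Dset → b ∈ pmD → b + d ∈ pmD →
      0 ≤ 9 * (b + b + d).1 + 3 * (b + b + d).2.1 + (b + b + d).2.2 →
      q ∈ S → q + b ∈ S → q + b + d ∈ S → q + b + b + d ∈ S →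
      F q + F (q + b + b + d) ≤ F (q + b) + F (q + b + d)) :
    DiscreteConcaveOn S F := by
  have oriented : ∀ q d b : V3, d ∈ Dset → b ∈ pmD → b + d ∈ pmD →
      q ∈ S → q + b ∈ S → q + b + d ∈ S → q + b + b + d ∈ S →
      F q + F (q + b + b + d) ≤ F (q + b) + F (q + b + d) := by
    intro q d b hd hb hbd hq h₁ h₂ h₃
    by_cases h₀ : 0 ≤ 9 * (b + b + d).1 + 3 * (b + b + d).2.1 + (b + b + d).2.2
    · exact h q d b hd hb hbd h₀ hq h₁ h₂ h₃
    · have e₁ : q + b + b + d + -(b + d) = q + b := by abel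
      have e₂ : q + b + b + d + -(b + d) + d = q + b + d := by abel
      have e₃ : q + b + b + d + -(b + d) + -(b + d) + d = q := by abel
      have := h (q + b + b + d) d (-(b + d)) hd (neg_mem_pmD.2 hbd)
        (by rwa [neg_add_rev, neg_add_cancel_comm, neg_mem_pmD])
        (by
          simp only [Prod.fst_add, Prod.snd_add, Prod.fst_neg, Prod.snd_neg] at h₀ ⊢
          omega)
        h₃ (by rwa [e₁]) (by rwa [e₂]) (by rwa [e₃])
      rw [e₃, e₂, e₁] at this
      linarith
  have short_sub : ∀ q a b : V3, a ∈ pmD → b ∈ pmD → a - b ∈ pmD → q ∈ S → q + a ∈ S →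
      q + b ∈ S → q + a + b ∈ S → F q + F (q + a + b) ≤ F (q + a) + F (q + b) := by
    intro q a b ha hb hd hq hqa hqb hqab
    rcases hd with hd | hd
    · have e₁ : q + b + (a - b) = q + a := by abel
      have e₂ : q + b + b + (a - b) = q + a + b := by abel
      have := oriented q (a - b) b hd hb (by rwa [add_sub_cancel]) hq hqb (by rwa [e₁])
        (by rwa [e₂])
      rw [e₁, e₂] at this
      linarith
    · rw [neg_sub] at hd
      have e₁ : q + a + (b - a) = q + b := by abel
      have e₂ : q + a + a + (b - a) = q + a + b := by abel
      have := oriented q (b - a) a hd ha (by rwa [add_sub_cancel]) hq hqa (by rwa [e₁])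
        (by rwa [e₂])
      rwa [e₁, e₂] at this
  intro q a b hab hq hqa hqb hqab
  refine ⟨fun hd => ?_, fun hd => short_sub q a b hab.1 hab.2.1 hd hq hqa hqb hqab⟩
  have := short_sub (q + a) (-a) b (neg_mem_pmD.2 hab.1) hab.2.1
    (by rwa [← neg_add', neg_mem_pmD]) hqa (by simpa using hq) hqab (by simpa using hqb)
  simpa using this

theorem DiscreteConcaveOn.mono {S T : Set V3} {F : V3 → ℝ} (h : DiscreteConcaveOn T F)
    (hST : S ⊆ T) : DiscreteConcaveOn S F := fun q a b hab hq hqa hqb hqab =>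
  h q a b hab (hST hq) (hST hqa) (hST hqb) (hST hqab)

theorem DiscreteConcaveOn.horizontalIneqs {n m : ℕ} {F : V3 → ℝ}
    (h : DiscreteConcaveOn (prismGround n m) F) :
    HorizontalIneqs n 0 fun x y z => F (x, y, z) := by
  refine ⟨fun x y hx hy hxy => ?_, fun x y hx hy hxy => ?_, fun x y hx hy hxy => ?_⟩
  · have := h.le x y 0 (-1) 1 0 0 1 0
    simp only [prismGround, Prism, Set.mem_ofPred_eq, mem_pmD, and_true] at this
    specialize this (by omega) (by omega) (by omega) (by omega) (by simp) (by simp) (by simp)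
    ring_nf at this ⊢
    linarith
  · have := h.le x y 0 1 0 0 0 1 0
    simp only [prismGround, Prism, Set.mem_ofPred_eq, mem_pmD, and_true] at this
    specialize this (by omega) (by omega) (by omega) (by omega) (by simp) (by simp) (by simp)
    ring_nf at this ⊢
    linarith
  · have := h.le x y 0 (-1) 0 0 (-1) 1 0
    simp only [prismGround, Prism, Set.mem_ofPred_eq, mem_pmD, and_true] at this
    specialize this (by omega) (by omega) (by omega) (by omega) (by simp) (by simp) (by simp)
    ring_nf at this ⊢
    linarith

theorem DiscreteConcaveOn.frontalIneqs {n m : ℕ} {F : V3 → ℝ}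
    (h : DiscreteConcaveOn (prismFront n m) F) :
    FrontalIneqs n m 0 fun x y z => F (x, y, z) := by
  refine ⟨fun x z hx hxy hz hzm => ?_, fun x z hx hxy hz hzm => ?_, fun x z hx hxy hz hzm => ?_⟩
  · have := h.le x 0 z (-1) 0 1 0 0 1
    simp only [prismFront, Prism, Set.mem_ofPred_eq, mem_pmD, and_true] at this
    specialize this (by omega) (by omega) (by omega) (by omega) (by simp) (by simp) (by simp)
    ring_nf at this ⊢
    linarith
  · have := h.le x 0 z 1 0 0 0 0 1
    simp only [prismFront, Prism, Set.mem_ofPred_eq, mem_pmD, and_true] at this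
    specialize this (by omega) (by omega) (by omega) (by omega) (by simp) (by simp) (by simp)
    ring_nf at this ⊢
    linarith
  · have := h.le x 0 z (-1) 0 0 (-1) 0 1
    simp only [prismFront, Prism, Set.mem_ofPred_eq, mem_pmD, and_true] at this
    specialize this (by omega) (by omega) (by omega) (by omega) (by simp) (by simp) (by simp)
    ring_nf at this ⊢
    linarith

/-- if a polarized function on the prism `P_{n,m}` has discrete concave
restrictions to the ground and the front wall, then all rhombus inequalities in the prism hold
(so `F` is polarized discrete concave); in particular the restrictions to the shadow wall and
to the ceiling are discrete concave. -/
theorem prism_polarized_discrete_concave (n m : ℕ) (F : V3 → ℝ)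
    (hpol : IsPolarizedPrism n m F)
    (hground : DiscreteConcaveOn (prismGround n m) F)
    (hfront : DiscreteConcaveOn (prismFront n m) F) :
    DiscreteConcaveOn (Prism n m) F ∧
      DiscreteConcaveOn (prismShadow n m) F ∧ DiscreteConcaveOn (prismCeiling n m) F := by
  have R := hpol.prismRecurrence
  have hz : ∀ z : ℤ, 0 ≤ z → z ≤ m → HorizontalIneqs n z fun x y z => F (x, y, z) :=
    fun z => R.horizontalIneqs hground.horizontalIneqs hfront.frontalIneqs
  have hy : ∀ y : ℤ, 0 ≤ y → FrontalIneqs n m y fun x y z => F (x, y, z) :=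
    fun y => R.frontalIneqs hground.horizontalIneqs hfront.frontalIneqs
  have main : DiscreteConcaveOn (Prism n m) F := by
    refine .of_le ?_
    rintro ⟨x, y, z⟩ d ⟨b₁, b₂, b₃⟩ hd hb hbd h₀ hq h₁ h₂ h₃
    rcases hd with rfl | rfl | rfl | rfl | rfl | rfl <;>
    rcases mem_pmD.1 hb with ⟨rfl, rfl, rfl⟩ | ⟨rfl, rfl, rfl⟩ | ⟨rfl, rfl, rfl⟩ |
      ⟨rfl, rfl, rfl⟩ | ⟨rfl, rfl, rfl⟩ | ⟨rfl, rfl, rfl⟩ | ⟨rfl, rfl, rfl⟩ | ⟨rfl, rfl, rfl⟩ |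
      ⟨rfl, rfl, rfl⟩ | ⟨rfl, rfl, rfl⟩ | ⟨rfl, rfl, rfl⟩ | ⟨rfl, rfl, rfl⟩ <;>
    simp only [e1, e2, e3, Prod.mk_sub_mk, Prod.mk_add_mk, Prism, Set.mem_ofPred_eq, mem_pmD]
      at h₀ hbd hq h₁ h₂ h₃ ⊢ <;>
    simp at h₀ hbd <;>
    ring_nf
    · have := (hz z (by omega) (by omega)).short_e1 (x + 1) (y - 2)
        (by omega) (by omega) (by omega)
      ring_nf at this
      linarith
    · have := (hy y (by omega)).short_e1 (x + 1) (z - 2)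
        (by omega) (by omega) (by omega) (by omega)
      ring_nf at this
      linarith
    · have := (hz z (by omega) (by omega)).short_e2 (x + 2) (y - 1)
        (by omega) (by omega) (by omega)
      ring_nf at this
      linarith
    · have H := (hy y (by omega)).short_e1 (x + 1) (z - 2) (by omega) (by omega) (by omega) (by omega)
      have := R.sagittal_short_e2 (x := x) (y := y) (z := z - 1)
        (by ring_nf at H ⊢; linarith) (by omega) (by omega) (by omega) (by omega) (by omega)
      ring_nf at this
      linarith
    · have := (hy y (by omega)).short_e3 (x + 2) (z - 1)
        (by omega) (by omega) (by omega) (by omega)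
      ring_nf at this
      linarith
    · have H := (hz (z - 1) (by omega) (by omega)).short_e1 (x + 1) y (by omega) (by omega) (by omega)
      have := R.sagittal_short_e3 (x := x) (y := y + 1) (z := z - 1)
        (by ring_nf at H ⊢; linarith) (by omega) (by omega) (by omega) (by omega) (by omega)
      ring_nf at this
      linarith
    · have := (hz z (by omega) (by omega)).short_e1_sub_e2 x y (by omega) (by omega) (by omega)
      ring_nf at this
      linarith
    · have H := (hy y (by omega)).short_e1 (x + 1) (z - 2) (by omega) (by omega) (by omega) (by omega)
      have := R.slanted_short_e1_sub_e2 (x := x + 1) (y := y) (z := z - 1)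
        (by ring_nf at H ⊢; linarith) (by omega) (by omega) (by omega) (by omega) (by omega)
      ring_nf at this
      linarith
    · have := (hy y (by omega)).short_e1_sub_e3 x z (by omega) (by omega) (by omega) (by omega)
      ring_nf at this
      linarith
    · have H := (hz z (by omega) (by omega)).short_e1 (x + 1) (y - 2) (by omega) (by omega) (by omega)
      have := R.slanted_short_e1_sub_e3 (x := x + 1) (y := y - 1) (z := z)
        (by ring_nf at H ⊢; linarith) (by omega) (by omega) (by omega) (by omega) (by omega)
      ring_nf at this
      linarith
    · have := R.sagittal_short_e2_sub_e3 (x := x) (hz z (by omega) (by omega)) (hy y (by omega))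
        (by omega) (by omega) (by omega) (by omega) (by omega)
      ring_nf at this
      linarith
    · have := R.slanted_short_e2_sub_e3 (x := x + 2) (hz (z - 1) (by omega) (by omega)) (hy (y - 1) (by omega))
        (by omega) (by omega) (by omega) (by omega) (by omega)
      ring_nf at this
      linarith
  exact ⟨main, main.mono fun _ h => h.1, main.mono fun _ h => h.1⟩
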